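/- Let X be a standard Gaussian random variable and let Y = H₄(X) = X⁴ − 6X² + 3. Define the operator S₄' f(y) = (−y² + 50y + 24) f(y) + (64y² + 72y − 1008) f'(y) + (16y³ − 48y² − 576y + 1728) f''(y). Let W be a real-valued random variable with E[W] = 0 and E[|W|³] < ∞. Then W is equal in law to H₄(X) if and only if E[S₄' f(W)] = 0 for all f ∈ F_{S₄',Y}. -/

import Mathlib

open MeasureTheory ProbabilityTheory Filter Set
open scoped Topology

/-- The standard Gaussian distribution, with density `(2π)^(-1/2) exp(-x²/2)` on `ℝ`. -/
noncomputable def stdGaussian : Measure ℝ :=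
  volume.withDensity fun x =>
    ENNReal.ofReal ((Real.sqrt (2 * Real.pi))⁻¹ * Real.exp (-x ^ 2 / 2))

/-- The law of `H₄(X) = X⁴ - 6X² + 3` for `X` standard Gaussian. -/
noncomputable def lawH4 : Measure ℝ :=
  Measure.map (fun x : ℝ => x ^ 4 - 6 * x ^ 2 + 3) stdGaussian

/-- The Stein operator `S₄' f(y) = (-y² + 50y + 24) f(y) + (64y² + 72y - 1008) f'(y)
+ (16y³ - 48y² - 576y + 1728) f''(y)` for `H₄(X)`. -/
noncomputable def steinH4' (f : ℝ → ℝ) (y : ℝ) : ℝ :=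
  (-y ^ 2 + 50 * y + 24) * f y + (64 * y ^ 2 + 72 * y - 1008) * deriv f y
    + (16 * y ^ 3 - 48 * y ^ 2 - 576 * y + 1728) * iteratedDeriv 2 f y

/-- Membership in the class `F_{S₄',Y}` (here `T = 2`, `m = 3`, `I = ℝ`). -/
def memFH4' (f : ℝ → ℝ) : Prop :=
  ContDiff ℝ 2 f ∧
    ∀ t ≤ 2, ∀ j ≤ 3, Integrable (fun y => y ^ j * iteratedDeriv t f y) lawH4

lemma stdGaussian_eq : _root_.stdGaussian = gaussianReal 0 1 := by
  rw [gaussianReal_of_var_ne_zero 0 one_ne_zero]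
  unfold _root_.stdGaussian
  congr 1
  ext x
  simp [gaussianPDF, gaussianPDFReal]

instance : IsProbabilityMeasure _root_.stdGaussian := by
  rw [stdGaussian_eq]; infer_instance

lemma measurable_h4 : Measurable (fun x : ℝ => x ^ 4 - 6 * x ^ 2 + 3) := by fun_prop

instance : IsProbabilityMeasure lawH4 :=
  Measure.isProbabilityMeasure_map measurable_h4.aemeasurable

lemma integrable_pow_gauss (n : ℕ) : Integrable (fun x : ℝ => x ^ n) _root_.stdGaussian := by
  rw [stdGaussian_eq]
  have h := (memLp_id_gaussianReal (μ := 0) (v := 1) (n : NNReal))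
  have := h.integrable_norm_pow'
  refine this.mono' (by fun_prop) (ae_of_all _ fun x => ?_)
  simp

lemma integrable_gauss_iff (g : ℝ → ℝ) : Integrable g _root_.stdGaussian ↔
    Integrable (fun x => ((Real.sqrt (2 * Real.pi))⁻¹ * Real.exp (-x ^ 2 / 2)) * g x) := by
  unfold _root_.stdGaussian
  rw [integrable_withDensity_iff_integrable_smul' (by fun_prop) (ae_of_all _ fun x => ENNReal.ofReal_lt_top)]
  refine integrable_congr (ae_of_all _ fun x => ?_)
  dsimp only
  rw [ENNReal.toReal_ofReal (by positivity), smul_eq_mul]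

lemma integral_gauss (g : ℝ → ℝ) : ∫ x, g x ∂_root_.stdGaussian =
    ∫ x, ((Real.sqrt (2 * Real.pi))⁻¹ * Real.exp (-x ^ 2 / 2)) * g x := by
  unfold _root_.stdGaussian
  rw [integral_withDensity_eq_integral_toReal_smul (by fun_prop) (ae_of_all _ fun x => ENNReal.ofReal_lt_top)]
  refine integral_congr_ae (ae_of_all _ fun x => ?_)
  dsimp only
  rw [ENNReal.toReal_ofReal (by positivity), smul_eq_mul]

lemma gauss_ibp (F F' : ℝ → ℝ) (hF : ∀ x, HasDerivAt F (F' x) x)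
    (hi : Integrable F _root_.stdGaussian)
    (hi' : Integrable (fun x => F' x - x * F x) _root_.stdGaussian) :
    ∫ x, (F' x - x * F x) ∂_root_.stdGaussian = 0 := by
  rw [integrable_gauss_iff] at hi hi'
  rw [integral_gauss]
  refine integral_eq_zero_of_hasDerivAt_of_integrable (fun x => ?_) hi' hi
  have h1 : HasDerivAt (fun x : ℝ => -x ^ 2 / 2) (-x) x := by
    have := ((hasDerivAt_pow 2 x).neg).div_const 2
    refine this.congr_deriv ?_
    simp
    ring
  have h2 := ((h1.exp.const_mul ((Real.sqrt (2 * Real.pi))⁻¹)).mul (hF x))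
  refine h2.congr_deriv ?_
  ring

lemma integral_id_lawH4 : ∫ y, y ∂lawH4 = 0 := by
  unfold lawH4
  rw [integral_map measurable_h4.aemeasurable (by fun_prop)]
  have hp := integrable_pow_gauss
  have hd : ∀ x : ℝ, HasDerivAt (fun x : ℝ => 3 * x - x ^ 3) (3 - 3 * x ^ 2) x := fun x => by
    have := ((hasDerivAt_id x).const_mul 3).sub (hasDerivAt_pow 3 x)
    refine this.congr_deriv ?_
    simp
  have hi1 : Integrable (fun x : ℝ => x) _root_.stdGaussian := by simpa using hp 1
  have hiF : Integrable (fun x : ℝ => 3 * x - x ^ 3) _root_.stdGaussian :=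
    (hi1.const_mul 3).sub (hp 3)
  have hiD : Integrable (fun x : ℝ => (3 - 3 * x ^ 2) - x * (3 * x - x ^ 3))
      _root_.stdGaussian := by
    have h4 : Integrable (fun x : ℝ => x ^ 4 - 6 * x ^ 2 + 3) _root_.stdGaussian :=
      ((hp 4).sub ((hp 2).const_mul 6)).add (integrable_const (3 : ℝ))
    have e : (fun x : ℝ => (3 - 3 * x ^ 2) - x * (3 * x - x ^ 3))
        = fun x : ℝ => x ^ 4 - 6 * x ^ 2 + 3 := by
      ext x; ring
    rw [e]; exact h4
  have h := gauss_ibp (fun x => 3 * x - x ^ 3) (fun x => 3 - 3 * x ^ 2) hd hiF hiD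
  rw [← h]
  refine integral_congr_ae (ae_of_all _ fun x => ?_)
  dsimp only
  ring

lemma integrable_pow_lawH4 (n : ℕ) : Integrable (fun y : ℝ => y ^ n) lawH4 := by
  unfold lawH4
  rw [integrable_map_measure (by fun_prop) measurable_h4.aemeasurable]
  have hb : Integrable (fun x : ℝ => (10 * (1 + x ^ 4)) ^ n) _root_.stdGaussian := by
    have : (fun x : ℝ => (10 * (1 + x ^ 4)) ^ n) = fun x =>
        10 ^ n * ∑ m ∈ Finset.range (n + 1), x ^ (4 * m) * (n.choose m : ℝ) := by
      ext x
      rw [mul_pow, add_comm, add_pow]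
      simp [pow_mul]
    rw [this]
    exact (integrable_finsetSum _ fun i _ => (integrable_pow_gauss _).mul_const _).const_mul _
  refine hb.mono' (by fun_prop) (ae_of_all _ fun x => ?_)
  simp only [Function.comp, norm_pow, Real.norm_eq_abs]
  gcongr
  rw [abs_le]
  constructor <;> nlinarith [sq_nonneg (x ^ 2 - 1), sq_nonneg x]

lemma boundA (x : ℝ) : |x ^ 7 - 5 * x ^ 5 - 33 * x ^ 3 + 165 * x| ≤
    816 * ((x ^ 4 - 6 * x ^ 2 + 3) + 16) ^ 2 := by
  have hk : 1 + x ^ 8 ≤ 4 * ((x ^ 4 - 6 * x ^ 2 + 3) + 16) ^ 2 := by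
    have : 1 + x ^ 4 ≤ 2 * ((x ^ 4 - 6 * x ^ 2 + 3) + 16) := by nlinarith [sq_nonneg (x ^ 2 - 6)]
    nlinarith [sq_nonneg (x ^ 2), pow_le_pow_left₀ (by positivity) this 2]
  have h7 : |x| ^ 7 ≤ 1 + x ^ 8 := by
    rw [← (by norm_num : Even 8).pow_abs x]
    rcases le_total |x| 1 with h | h
    · have := pow_le_one₀ (abs_nonneg x) h (n := 7); nlinarith [pow_nonneg (abs_nonneg x) 8]
    · have := pow_le_pow_right₀ h (show 7 ≤ 8 by norm_num); linarith
  have h5 : |x| ^ 5 ≤ 1 + x ^ 8 := by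
    rw [← (by norm_num : Even 8).pow_abs x]
    rcases le_total |x| 1 with h | h
    · have := pow_le_one₀ (abs_nonneg x) h (n := 5); nlinarith [pow_nonneg (abs_nonneg x) 8]
    · have := pow_le_pow_right₀ h (show 5 ≤ 8 by norm_num); linarith
  have h3 : |x| ^ 3 ≤ 1 + x ^ 8 := by
    rw [← (by norm_num : Even 8).pow_abs x]
    rcases le_total |x| 1 with h | h
    · have := pow_le_one₀ (abs_nonneg x) h (n := 3); nlinarith [pow_nonneg (abs_nonneg x) 8]
    · have := pow_le_pow_right₀ h (show 3 ≤ 8 by norm_num); linarith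
  have h1 : |x| ≤ 1 + x ^ 8 := by
    rw [← (by norm_num : Even 8).pow_abs x]
    rcases le_total |x| 1 with h | h
    · nlinarith [pow_nonneg (abs_nonneg x) 8]
    · have := pow_le_pow_right₀ h (show 1 ≤ 8 by norm_num); linarith
  rw [← abs_pow] at h7 h5 h3
  rw [abs_le] at *
  constructor <;> linarith

lemma boundB (x : ℝ) : |4 * x ^ 9 - 60 * x ^ 7 + 276 * x ^ 5 - 324 * x ^ 3 - 216 * x| ≤
    7040 * ((x ^ 4 - 6 * x ^ 2 + 3) + 16) ^ 3 := by
  have hk : 1 + x ^ 12 ≤ 8 * ((x ^ 4 - 6 * x ^ 2 + 3) + 16) ^ 3 := by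
    have : 1 + x ^ 4 ≤ 2 * ((x ^ 4 - 6 * x ^ 2 + 3) + 16) := by nlinarith [sq_nonneg (x ^ 2 - 6)]
    have h2 := pow_le_pow_left₀ (by positivity) this 3
    have h3 : 0 ≤ x ^ 4 := by positivity
    have h4 : 0 ≤ x ^ 8 := by positivity
    nlinarith
  have key : ∀ k : ℕ, k ≤ 12 → |x ^ k| ≤ 1 + x ^ 12 := by
    intro k hk
    rw [← (by norm_num : Even 12).pow_abs x, abs_pow]
    rcases le_total |x| 1 with h | h
    · have := pow_le_one₀ (abs_nonneg x) h (n := k); nlinarith [pow_nonneg (abs_nonneg x) 12]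
    · have := pow_le_pow_right₀ h hk; linarith
  have h9 := key 9 (by norm_num)
  have h7 := key 7 (by norm_num)
  have h5 := key 5 (by norm_num)
  have h3 := key 3 (by norm_num)
  have h1 := key 1 (by norm_num)
  rw [abs_le] at *
  rw [pow_one] at h1
  constructor <;> linarith

lemma stein_lawH4 (f : ℝ → ℝ) (hf : memFH4' f) : ∫ y, steinH4' f y ∂lawH4 = 0 := by
  obtain ⟨hc, hint⟩ := hf
  have hd1 : ContDiff ℝ 1 (deriv f) := by
    have h2 : ContDiff ℝ (1 + 1) f := by simpa [one_add_one_eq_two] using hc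
    exact (contDiff_succ_iff_deriv.1 h2).2.2
  have hf0 : ∀ y, HasDerivAt f (deriv f y) y := fun y =>
    (hc.differentiable (by norm_num) y).hasDerivAt
  have e2 : iteratedDeriv 2 f = deriv (deriv f) := by
    rw [iteratedDeriv_succ, iteratedDeriv_one]
  have hf1 : ∀ y, HasDerivAt (deriv f) (iteratedDeriv 2 f y) y := fun y => by
    rw [e2]; exact (hd1.differentiable (by norm_num) y).hasDerivAt
  have c0 : Continuous f := hc.continuous
  have c1 : Continuous (deriv f) := hd1.continuous
  have c2 : Continuous (iteratedDeriv 2 f) := hc.continuous_iteratedDeriv 2 le_rfl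
  have i0 : ∀ j ≤ 3, Integrable (fun y => y ^ j * f y) lawH4 := fun j hj => by
    simpa using hint 0 (by norm_num) j hj
  have i1 : ∀ j ≤ 3, Integrable (fun y => y ^ j * deriv f y) lawH4 := fun j hj => by
    simpa using hint 1 (by norm_num) j hj
  have i2 := hint 2 le_rfl
  have hSi : Integrable (steinH4' f) lawH4 := by
    have a := (((i0 2 (by norm_num)).neg.add ((i0 1 (by norm_num)).const_mul 50)).add
      ((i0 0 (by norm_num)).const_mul 24))
    have b := ((((i1 2 (by norm_num)).const_mul 64).add ((i1 1 (by norm_num)).const_mul 72)).sub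
      ((i1 0 (by norm_num)).const_mul 1008))
    have c := (((((i2 3 (by norm_num)).const_mul 16).sub ((i2 2 (by norm_num)).const_mul 48)).sub
      ((i2 1 (by norm_num)).const_mul 576)).add ((i2 0 (by norm_num)).const_mul 1728))
    refine ((a.add b).add c).congr (ae_of_all _ fun y => ?_)
    simp only [Pi.add_apply, Pi.sub_apply, Pi.neg_apply, steinH4']
    ring
  have iA : Integrable (fun y => 816 * (y + 16) ^ 2 * f y) lawH4 := by
    have a := ((((i0 2 (by norm_num)).add ((i0 1 (by norm_num)).const_mul 32)).add
      ((i0 0 (by norm_num)).const_mul 256)).const_mul 816)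
    refine a.congr (ae_of_all _ fun y => ?_)
    simp only [Pi.add_apply]
    ring
  have iB : Integrable (fun y => 7040 * (y + 16) ^ 3 * deriv f y) lawH4 := by
    have a := (((((i1 3 (by norm_num)).add ((i1 2 (by norm_num)).const_mul 48)).add
      ((i1 1 (by norm_num)).const_mul 768)).add ((i1 0 (by norm_num)).const_mul 4096)).const_mul
      7040)
    refine a.congr (ae_of_all _ fun y => ?_)
    simp only [Pi.add_apply]
    ring
  have cS : Continuous (steinH4' f) := by unfold steinH4'; fun_prop
  unfold lawH4 at *
  rw [integrable_map_measure (Continuous.aestronglyMeasurable (by fun_prop))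
    measurable_h4.aemeasurable] at iA iB hSi
  rw [integral_map measurable_h4.aemeasurable cS.aestronglyMeasurable]
  have jA : Integrable (fun x : ℝ => (x ^ 7 - 5 * x ^ 5 - 33 * x ^ 3 + 165 * x) *
      f (x ^ 4 - 6 * x ^ 2 + 3)) _root_.stdGaussian := by
    refine iA.norm.mono' (Continuous.aestronglyMeasurable (by fun_prop)) (ae_of_all _ fun x => ?_)
    simp only [Function.comp, norm_mul, norm_pow, Real.norm_eq_abs]
    refine mul_le_mul_of_nonneg_right ((boundA x).trans ?_) (abs_nonneg _)
    rw [sq_abs]; norm_num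
  have jB : Integrable (fun x : ℝ =>
      (4 * x ^ 9 - 60 * x ^ 7 + 276 * x ^ 5 - 324 * x ^ 3 - 216 * x) *
      deriv f (x ^ 4 - 6 * x ^ 2 + 3)) _root_.stdGaussian := by
    refine iB.norm.mono' (Continuous.aestronglyMeasurable (by fun_prop)) (ae_of_all _ fun x => ?_)
    simp only [Function.comp, norm_mul, Real.norm_eq_abs]
    refine mul_le_mul_of_nonneg_right ((boundB x).trans ?_) (abs_nonneg _)
    rw [abs_of_pos (by norm_num : (0:ℝ) < 7040)]
    gcongr
    exact le_abs_self _
  have hh : ∀ x : ℝ, HasDerivAt (fun x : ℝ => x ^ 4 - 6 * x ^ 2 + 3) (4 * x ^ 3 - 12 * x) x := by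
    intro x
    have := (((hasDerivAt_pow 4 x).sub ((hasDerivAt_pow 2 x).const_mul 6)).add_const 3)
    refine this.congr_deriv ?_
    simp
    ring
  have hA : ∀ x : ℝ, HasDerivAt (fun x : ℝ => x ^ 7 - 5 * x ^ 5 - 33 * x ^ 3 + 165 * x)
      (7 * x ^ 6 - 25 * x ^ 4 - 99 * x ^ 2 + 165) x := by
    intro x
    have := ((((hasDerivAt_pow 7 x).sub ((hasDerivAt_pow 5 x).const_mul 5)).sub
      ((hasDerivAt_pow 3 x).const_mul 33)).add ((hasDerivAt_id x).const_mul 165))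
    refine this.congr_deriv ?_
    simp
    ring
  have hB : ∀ x : ℝ, HasDerivAt (fun x : ℝ =>
      4 * x ^ 9 - 60 * x ^ 7 + 276 * x ^ 5 - 324 * x ^ 3 - 216 * x)
      (36 * x ^ 8 - 420 * x ^ 6 + 1380 * x ^ 4 - 972 * x ^ 2 - 216) x := by
    intro x
    have := (((((hasDerivAt_pow 9 x).const_mul 4).sub ((hasDerivAt_pow 7 x).const_mul 60)).add
      ((hasDerivAt_pow 5 x).const_mul 276)).sub
      ((hasDerivAt_pow 3 x).const_mul 324)).sub ((hasDerivAt_id x).const_mul 216)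
    refine this.congr_deriv ?_
    simp
    ring
  have hF := fun x : ℝ => ((hA x).mul ((hf0 (x ^ 4 - 6 * x ^ 2 + 3)).comp x (hh x))).add
    ((hB x).mul ((hf1 (x ^ 4 - 6 * x ^ 2 + 3)).comp x (hh x)))
  have hpt : ∀ x : ℝ, steinH4' f (x ^ 4 - 6 * x ^ 2 + 3) =
      ((7 * x ^ 6 - 25 * x ^ 4 - 99 * x ^ 2 + 165) * f (x ^ 4 - 6 * x ^ 2 + 3) +
        (x ^ 7 - 5 * x ^ 5 - 33 * x ^ 3 + 165 * x) *
          (deriv f (x ^ 4 - 6 * x ^ 2 + 3) * (4 * x ^ 3 - 12 * x)) +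
        ((36 * x ^ 8 - 420 * x ^ 6 + 1380 * x ^ 4 - 972 * x ^ 2 - 216) *
          deriv f (x ^ 4 - 6 * x ^ 2 + 3) +
        (4 * x ^ 9 - 60 * x ^ 7 + 276 * x ^ 5 - 324 * x ^ 3 - 216 * x) *
          (iteratedDeriv 2 f (x ^ 4 - 6 * x ^ 2 + 3) * (4 * x ^ 3 - 12 * x)))) - x *
        ((x ^ 7 - 5 * x ^ 5 - 33 * x ^ 3 + 165 * x) * f (x ^ 4 - 6 * x ^ 2 + 3) +
        (4 * x ^ 9 - 60 * x ^ 7 + 276 * x ^ 5 - 324 * x ^ 3 - 216 * x) *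
          deriv f (x ^ 4 - 6 * x ^ 2 + 3)) := fun x => by
    simp only [steinH4']
    ring
  have hfin := gauss_ibp _ _ hF (jA.add jB) (hSi.congr (ae_of_all _ fun x => hpt x))
  rw [← hfin]
  exact integral_congr_ae (ae_of_all _ fun x => hpt x)

lemma ode_energy (u v w t T : ℝ) (ht : 0 < t) (htT : t ≤ T) (hu : 0 ≤ u) (hv : 0 ≤ v)
    (hw : 0 ≤ w) (P Q R : ℝ)
    (hP : 16 * t ^ 2 * P ≤ -64 * t * u ^ 2 + u * (50 * (t * v) + 24 * (t ^ 2 * w)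
      + 72 * t * (t * v) + 1008 * t * (t ^ 2 * w) + 576 * t ^ 2 * (t * v)
      + 1728 * t ^ 2 * (t ^ 2 * w)))
    (hQ : Q ≤ t * v * u) (hR : R ≤ t ^ 2 * w * (t * v)) :
    2 * P + 3 * (2 * Q / t ^ 2 - 2 * v ^ 2 / t) + (2 * R / t ^ 4 - 4 * w ^ 2 / t)
      ≤ 2 * (6 + 99 * T + 108 * T ^ 2) * (u ^ 2 + 3 * v ^ 2 + w ^ 2) := by
  have hP' : P ≤ -4 * u ^ 2 / t + u * (50 / 16 * v / t + 3 / 2 * w + 9 / 2 * v + 63 * t * w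
      + 36 * t * v + 108 * t ^ 2 * w) := by
    have h16 : 0 < 16 * t ^ 2 := by positivity
    refine le_of_mul_le_mul_left (hP.trans (le_of_eq ?_)) h16
    field_simp
    ring
  have hQ' : Q / t ^ 2 ≤ v * u / t := by
    rw [div_le_div_iff₀ (by positivity) ht]
    nlinarith
  have hR' : R / t ^ 4 ≤ w * v / t := by
    rw [div_le_div_iff₀ (by positivity) ht]
    nlinarith
  have hquad : (-4 * u ^ 2 + 50 / 16 * u * v + 3 * u * v - 3 * v ^ 2 + w * v - 2 * w ^ 2) / t ≤ 0 := by
    apply div_nonpos_of_nonpos_of_nonneg _ ht.le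
    nlinarith [sq_nonneg (u - 49 / 64 * v), sq_nonneg (w - v / 4)]
  have huv : u * v ≤ (u ^ 2 + 3 * v ^ 2 + w ^ 2) / 2 := by nlinarith [sq_nonneg (u - v), sq_nonneg v, sq_nonneg w]
  have huw : u * w ≤ (u ^ 2 + 3 * v ^ 2 + w ^ 2) / 2 := by nlinarith [sq_nonneg (u - w), sq_nonneg v, sq_nonneg w]
  set S := u ^ 2 + 3 * v ^ 2 + w ^ 2 with hS
  have hS0 : 0 ≤ S := by positivity
  have hrest : u * (3 / 2 * w + 9 / 2 * v + 63 * t * w + 36 * t * v + 108 * t ^ 2 * w) ≤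
      (6 + 99 * T + 108 * T ^ 2) * S := by
    have hT : 0 ≤ T := by linarith
    have ht2 : t ^ 2 ≤ T ^ 2 := by nlinarith
    have a1 : t * (u * w) ≤ T * (S / 2) := by gcongr
    have a2 : t * (u * v) ≤ T * (S / 2) := by gcongr
    have a3 : t ^ 2 * (u * w) ≤ T ^ 2 * (S / 2) := by gcongr
    have hT : 0 ≤ T := by linarith
    nlinarith [mul_nonneg hT hS0, mul_nonneg (sq_nonneg T) hS0]
  have e : 2 * P + 3 * (2 * Q / t ^ 2 - 2 * v ^ 2 / t) + (2 * R / t ^ 4 - 4 * w ^ 2 / t)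
     = 2 * P + 6 * (Q / t ^ 2) + 2 * (R / t ^ 4) - 6 * v ^ 2 / t - 4 * w ^ 2 / t := by ring
  rw [e]
  have e2 : 2 * (-4 * u ^ 2 / t + u * (50 / 16 * v / t + 3 / 2 * w + 9 / 2 * v + 63 * t * w
      + 36 * t * v + 108 * t ^ 2 * w)) + 6 * (v * u / t) + 2 * (w * v / t) - 6 * v ^ 2 / t
      - 4 * w ^ 2 / t = 2 * ((-4 * u ^ 2 + 50 / 16 * u * v + 3 * u * v - 3 * v ^ 2 + w * v
      - 2 * w ^ 2) / t) + 2 * (u * (3 / 2 * w + 9 / 2 * v + 63 * t * w + 36 * t * v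
      + 108 * t ^ 2 * w)) := by ring
  linarith

open Complex in
lemma ode_inner (D0 D1 D2 D3 : ℂ) (t : ℝ) (ht : 0 < t)
    (hode : (-D2 + 50 * D1 + 24 * D0) + (I * t) * (64 * D2 + 72 * D1 - 1008 * D0)
      - (t : ℂ) ^ 2 * (16 * D3 - 48 * D2 - 576 * D1 + 1728 * D0) = 0) :
    16 * t ^ 2 * inner ℝ D2 (I * D3) ≤ -64 * t * ‖D2‖ ^ 2 + ‖D2‖ * (50 * ‖D1‖ + 24 * ‖D0‖
      + 72 * t * ‖D1‖ + 1008 * t * ‖D0‖ + 576 * t ^ 2 * ‖D1‖ + 1728 * t ^ 2 * ‖D0‖) := by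
  set Z : ℂ := I * (50 * D1 + 24 * D0) - t * (72 * D1 - 1008 * D0)
    + I * (t : ℂ) ^ 2 * (576 * D1 - 1728 * D0) with hZ
  have e : ((16 * t ^ 2 : ℝ) : ℂ) * (I * D3) = ((-64 * t : ℝ) : ℂ) * D2
      + ((-1 + 48 * t ^ 2 : ℝ) : ℂ) * (I * D2) + Z := by
    push_cast
    rw [hZ]
    linear_combination (-I) * hode + (64 * D2 * t + 72 * D1 * t - 1008 * D0 * t) * I_sq
  have e2 : 16 * t ^ 2 * inner ℝ D2 (I * D3) = -64 * t * ‖D2‖ ^ 2 + inner ℝ D2 Z := by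
    have : 16 * t ^ 2 * inner ℝ D2 (I * D3) = inner ℝ D2 (((16 * t ^ 2 : ℝ) : ℂ) * (I * D3)) := by
      rw [← real_smul, inner_smul_right]
    rw [this, e, inner_add_right, inner_add_right, ← real_smul, ← real_smul, inner_smul_right,
      inner_smul_right, real_inner_self_eq_norm_sq]
    have : inner ℝ D2 (I * D2) = 0 := by
      simp [Complex.inner]
      ring
    rw [this]; ring
  rw [e2]
  have hn : ‖Z‖ ≤ 50 * ‖D1‖ + 24 * ‖D0‖
      + 72 * t * ‖D1‖ + 1008 * t * ‖D0‖ + 576 * t ^ 2 * ‖D1‖ + 1728 * t ^ 2 * ‖D0‖ := by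
    have b1 : ‖I * (50 * D1 + 24 * D0)‖ ≤ 50 * ‖D1‖ + 24 * ‖D0‖ := by
      rw [norm_mul, norm_I, one_mul]
      refine (norm_add_le _ _).trans ?_
      simp
    have b2 : ‖(t : ℂ) * (72 * D1 - 1008 * D0)‖ ≤ t * (72 * ‖D1‖ + 1008 * ‖D0‖) := by
      rw [norm_mul, norm_real, Real.norm_of_nonneg ht.le]
      gcongr
      refine (norm_sub_le _ _).trans ?_
      simp
    have b3 : ‖I * (t : ℂ) ^ 2 * (576 * D1 - 1728 * D0)‖ ≤ t ^ 2 * (576 * ‖D1‖ + 1728 * ‖D0‖) := by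
      rw [norm_mul, norm_mul, norm_I, one_mul, norm_pow, norm_real, Real.norm_of_nonneg ht.le]
      gcongr
      refine (norm_sub_le _ _).trans ?_
      simp
    have := (norm_add_le (I * (50 * D1 + 24 * D0) - t * (72 * D1 - 1008 * D0))
      (I * (t : ℂ) ^ 2 * (576 * D1 - 1728 * D0)))
    have h' := norm_sub_le (I * (50 * D1 + 24 * D0)) (t * (72 * D1 - 1008 * D0))
    rw [hZ]
    linarith
  have := real_inner_le_norm D2 Z
  have h3 : ‖D2‖ * ‖Z‖ ≤ _ := mul_le_mul_of_nonneg_left hn (norm_nonneg D2)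
  linarith

open Complex in
lemma bound_of_deriv (f g : ℝ → ℂ) (hf : ∀ t, HasDerivAt f (I * g t) t) (h0 : f 0 = 0)
    (C t : ℝ) (ht : 0 ≤ t) (hg : ∀ s ∈ Icc 0 t, ‖g s‖ ≤ C) : ‖f t‖ ≤ C * t := by
  have := (convex_Icc 0 t).norm_image_sub_le_of_norm_hasDerivWithin_le (f := f)
    (f' := fun s => I * g s) (C := C) (fun s _ => (hf s).hasDerivWithinAt)
    (fun s hs => by simpa using hg s hs) (left_mem_Icc.2 ht) (right_mem_Icc.2 ht)
  simpa [h0, abs_of_nonneg ht] using this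

open Complex in
lemma ode_unique (D0 D1 D2 D3 : ℝ → ℂ) (d0 : ∀ t, HasDerivAt D0 (I * D1 t) t)
    (d1 : ∀ t, HasDerivAt D1 (I * D2 t) t) (d2 : ∀ t, HasDerivAt D2 (I * D3 t) t)
    (z0 : D0 0 = 0) (z1 : D1 0 = 0)
    (hode : ∀ t : ℝ, (-D2 t + 50 * D1 t + 24 * D0 t)
      + (I * t) * (64 * D2 t + 72 * D1 t - 1008 * D0 t)
      - (t : ℂ) ^ 2 * (16 * D3 t - 48 * D2 t - 576 * D1 t + 1728 * D0 t) = 0)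
    (T : ℝ) (hT : 0 < T) : D0 T = 0 := by
  have z2 : D2 0 = 0 := by simpa [z0, z1] using hode 0
  set K : ℝ := 2 * (6 + 99 * T + 108 * T ^ 2) with hK
  set V : ℝ → ℝ := fun t => ‖D2 t‖ ^ 2 + 3 * (‖D1 t‖ ^ 2 / t ^ 2) + ‖D0 t‖ ^ 2 / t ^ 4 with hV
  have hVd : ∀ t, 0 < t → HasDerivAt V (2 * inner ℝ (D2 t) (I * D3 t)
      + 3 * (2 * inner ℝ (D1 t) (I * D2 t) / t ^ 2 - 2 * (‖D1 t‖ / t) ^ 2 / t)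
      + (2 * inner ℝ (D0 t) (I * D1 t) / t ^ 4 - 4 * (‖D0 t‖ / t ^ 2) ^ 2 / t)) t := by
    intro t ht
    have h := ((d2 t).norm_sq.add (((d1 t).norm_sq.div (hasDerivAt_pow 2 t)
      (by positivity)).const_mul 3)).add ((d0 t).norm_sq.div (hasDerivAt_pow 4 t) (by positivity))
    refine h.congr_deriv ?_
    simp
    field_simp
  have hVle : ∀ t, 0 < t → t ≤ T → 2 * inner ℝ (D2 t) (I * D3 t)
      + 3 * (2 * inner ℝ (D1 t) (I * D2 t) / t ^ 2 - 2 * (‖D1 t‖ / t) ^ 2 / t)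
      + (2 * inner ℝ (D0 t) (I * D1 t) / t ^ 4 - 4 * (‖D0 t‖ / t ^ 2) ^ 2 / t) ≤ K * V t := by
    intro t ht htT
    have a1 : t * (‖D1 t‖ / t) = ‖D1 t‖ := by field_simp
    have a0 : t ^ 2 * (‖D0 t‖ / t ^ 2) = ‖D0 t‖ := by field_simp
    have h := ode_energy ‖D2 t‖ (‖D1 t‖ / t) (‖D0 t‖ / t ^ 2) t T ht htT (by positivity)
      (by positivity) (by positivity) (inner ℝ (D2 t) (I * D3 t)) (inner ℝ (D1 t) (I * D2 t))
      (inner ℝ (D0 t) (I * D1 t))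
      (by rw [a1, a0]; exact ode_inner _ _ _ _ t ht (hode t))
      (by rw [a1]; refine (real_inner_le_norm _ _).trans (by simp))
      (by rw [a1, a0]; refine (real_inner_le_norm _ _).trans (by simp))
    refine h.trans (le_of_eq ?_)
    rw [hV]
    ring
  have hanti : AntitoneOn (fun t => Real.exp (-(K * t)) * V t) (Ioc 0 T) := by
    have hd : ∀ t, 0 < t → HasDerivAt (fun t => Real.exp (-(K * t)) * V t) _ t := fun t ht =>
      (((hasDerivAt_id t).const_mul K).neg.exp).mul (hVd t ht)
    refine antitoneOn_of_deriv_nonpos (convex_Ioc 0 T)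
      (fun t ht => (hd t ht.1).continuousAt.continuousWithinAt) (fun t ht => ?_) (fun t ht => ?_)
    · rw [interior_Ioc] at ht
      exact (hd t ht.1).differentiableAt.differentiableWithinAt
    · rw [interior_Ioc] at ht
      rw [(hd t ht.1).deriv]
      have := hVle t ht.1 ht.2.le
      have he := Real.exp_pos (-(K * t))
      simp only [id, Pi.neg_apply, mul_one]
      nlinarith
  have hV0 : ∀ t, 0 ≤ V t := fun t => by simp only [hV]; positivity
  have hK0 : 0 ≤ K := by positivity
  have hsmall : ∀ ε > 0, Real.exp (-(K * T)) * V T ≤ 5 * ε ^ 2 := by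
    intro ε hε
    have hcont := (d2 0).continuousAt
    rw [Metric.continuousAt_iff] at hcont
    obtain ⟨δ, hδ, hb⟩ := hcont ε hε
    set s := min (δ / 2) T with hs
    have hs0 : 0 < s := by positivity
    have hsδ : s < δ := (min_le_left _ _).trans_lt (by linarith)
    have b2 : ∀ r ∈ Icc 0 s, ‖D2 r‖ ≤ ε := fun r hr => by
      have := hb (x := r) (by simp [abs_of_nonneg hr.1]; linarith [hr.2])
      simpa [z2] using this.le
    have b1 : ∀ r ∈ Icc 0 s, ‖D1 r‖ ≤ ε * r := fun r hr =>
      bound_of_deriv D1 D2 d1 z1 ε r hr.1 fun q hq => b2 q ⟨hq.1, hq.2.trans hr.2⟩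
    have b0 : ‖D0 s‖ ≤ ε * s * s := bound_of_deriv D0 D1 d0 z0 _ s hs0.le fun q hq =>
      (b1 q hq).trans (by have := hq.2; gcongr)
    have hle := hanti ⟨hs0, min_le_right _ _⟩ ⟨hT, le_rfl⟩ (min_le_right _ _)
    refine hle.trans ?_
    have hVs : V s ≤ 5 * ε ^ 2 := by
      simp only [hV]
      have c2 : ‖D2 s‖ ^ 2 ≤ ε ^ 2 := by
        have := b2 s ⟨hs0.le, le_rfl⟩; gcongr
      have c1 : ‖D1 s‖ ^ 2 / s ^ 2 ≤ ε ^ 2 := by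
        rw [div_le_iff₀ (by positivity), ← mul_pow]
        have := b1 s ⟨hs0.le, le_rfl⟩; gcongr
      have c0 : ‖D0 s‖ ^ 2 / s ^ 4 ≤ ε ^ 2 := by
        rw [div_le_iff₀ (by positivity), show ε ^ 2 * s ^ 4 = (ε * s * s) ^ 2 by ring]
        gcongr
      linarith
    have : Real.exp (-(K * s)) ≤ 1 := Real.exp_le_one_iff.2 (by have := mul_nonneg hK0 hs0.le; linarith)
    have hh : Real.exp (-(K * s)) * V s ≤ 1 * V s := mul_le_mul_of_nonneg_right this (hV0 s)
    linarith
  have hz : Real.exp (-(K * T)) * V T ≤ 0 := by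
    by_contra hcon
    push Not at hcon
    set c := Real.exp (-(K * T)) * V T
    have := hsmall (Real.sqrt (c / 10)) (Real.sqrt_pos.2 (by positivity))
    rw [Real.sq_sqrt (by positivity)] at this
    linarith
  have hVT : V T ≤ 0 := by
    have := Real.exp_pos (-(K * T))
    by_contra hcon
    push Not at hcon
    have := mul_pos this hcon
    linarith
  have h1 : ‖D0 T‖ ^ 2 / T ^ 4 ≤ 0 := by
    have : 0 ≤ ‖D2 T‖ ^ 2 + 3 * (‖D1 T‖ ^ 2 / T ^ 2) := by positivity
    simp only [hV] at hVT
    linarith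
  rw [div_le_iff₀ (by positivity), zero_mul] at h1
  have := pow_eq_zero_iff (two_ne_zero) |>.1 (le_antisymm h1 (by positivity))
  simpa using this

/-- Moment-weighted characteristic function. -/
noncomputable def mcf (μ : Measure ℝ) (j : ℕ) (t : ℝ) : ℂ :=
  ∫ y, (y : ℂ) ^ j * Complex.exp (t * y * Complex.I) ∂μ

lemma norm_mcf_integrand (j : ℕ) (t y : ℝ) :
    ‖(y : ℂ) ^ j * Complex.exp (t * y * Complex.I)‖ = |y ^ j| := by
  rw [norm_mul, ← Complex.ofReal_mul, Complex.norm_exp_ofReal_mul_I, mul_one, norm_pow,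
    Complex.norm_real, Real.norm_eq_abs, abs_pow]

lemma integrable_mcf (μ : Measure ℝ) (j : ℕ) (t : ℝ) (h : Integrable (fun y : ℝ => y ^ j) μ) :
    Integrable (fun y : ℝ => (y : ℂ) ^ j * Complex.exp (t * y * Complex.I)) μ := by
  refine h.norm.mono' (Continuous.aestronglyMeasurable (by fun_prop)) (ae_of_all _ fun y => ?_)
  rw [norm_mcf_integrand, Real.norm_eq_abs]

lemma hasDerivAt_mcf (μ : Measure ℝ) (j : ℕ) (t : ℝ) (h : Integrable (fun y : ℝ => y ^ j) μ)
    (h' : Integrable (fun y : ℝ => y ^ (j + 1)) μ) :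
    HasDerivAt (mcf μ j) (Complex.I * mcf μ (j + 1) t) t := by
  have := (hasDerivAt_integral_of_dominated_loc_of_deriv_le (μ := μ) (𝕜 := ℝ) (s := univ)
    (F := fun (t : ℝ) (y : ℝ) => (y : ℂ) ^ j * Complex.exp (t * y * Complex.I))
    (F' := fun (t : ℝ) (y : ℝ) =>
      Complex.I * ((y : ℂ) ^ (j + 1) * Complex.exp (t * y * Complex.I)))
    (x₀ := t) (bound := fun y => |y ^ (j + 1)|) univ_mem
    (Eventually.of_forall fun t => Continuous.aestronglyMeasurable (by fun_prop))
    (integrable_mcf μ j t h) (Continuous.aestronglyMeasurable (by fun_prop))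
    (ae_of_all _ fun y t _ => by
      rw [norm_mul, norm_mcf_integrand, Complex.norm_I, one_mul])
    h'.abs (ae_of_all _ fun y t _ => ?_)).2
  · rw [integral_const_mul] at this
    exact this
  · have h1 : HasDerivAt (fun t : ℝ => (t : ℂ) * y * Complex.I) (1 * y * Complex.I) t :=
      ((Complex.ofRealCLM.hasDerivAt (x := t)).mul_const _).mul_const _
    have h2 := h1.cexp.const_mul ((y : ℂ) ^ j)
    refine h2.congr_deriv ?_
    ring

lemma trig_deriv (a b t : ℝ) : deriv (fun y : ℝ => a * Real.cos (t * y) + b * Real.sin (t * y))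
    = fun y => (b * t) * Real.cos (t * y) + (-(a * t)) * Real.sin (t * y) := by
  ext y
  have h : HasDerivAt (fun y : ℝ => t * y) t y := by simpa using (hasDerivAt_id y).const_mul t
  have := ((h.cos.const_mul a).add (h.sin.const_mul b)).deriv
  refine Eq.trans this ?_
  ring

lemma trig_iter2 (a b t : ℝ) :
    iteratedDeriv 2 (fun y : ℝ => a * Real.cos (t * y) + b * Real.sin (t * y))
    = fun y => (-(a * t) * t) * Real.cos (t * y) + (-(b * t * t)) * Real.sin (t * y) := by
  rw [iteratedDeriv_succ, iteratedDeriv_one, trig_deriv, trig_deriv]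

lemma trig_int (a b t : ℝ) (j : ℕ) : Integrable
    (fun y : ℝ => y ^ j * (a * Real.cos (t * y) + b * Real.sin (t * y))) lawH4 := by
  refine ((integrable_pow_lawH4 j).norm.mul_const (|a| + |b|)).mono'
    (Continuous.aestronglyMeasurable (by fun_prop)) (ae_of_all _ fun y => ?_)
  rw [norm_mul]
  gcongr
  refine (norm_add_le _ _).trans ?_
  simp only [norm_mul, Real.norm_eq_abs]
  exact add_le_add (mul_le_of_le_one_right (abs_nonneg _) (Real.abs_cos_le_one _))
    (mul_le_of_le_one_right (abs_nonneg _) (Real.abs_sin_le_one _))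

lemma trig_mem (a b t : ℝ) :
    memFH4' (fun y : ℝ => a * Real.cos (t * y) + b * Real.sin (t * y)) := by
  refine ⟨by fun_prop, fun k hk j _ => ?_⟩
  interval_cases k
  · simpa using trig_int a b t j
  · rw [iteratedDeriv_one, trig_deriv]; exact trig_int _ _ t j
  · rw [trig_iter2]; exact trig_int _ _ t j

open Complex in
lemma mcf_ode (μ : Measure ℝ) (hm : ∀ j ≤ 3, Integrable (fun y : ℝ => y ^ j) μ)
    (hS : ∀ f, memFH4' f → ∫ y, steinH4' f y ∂μ = 0) (t : ℝ) :
    (-mcf μ 2 t + 50 * mcf μ 1 t + 24 * mcf μ 0 t)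
      + (I * t) * (64 * mcf μ 2 t + 72 * mcf μ 1 t - 1008 * mcf μ 0 t)
      - (t : ℂ) ^ 2 * (16 * mcf μ 3 t - 48 * mcf μ 2 t - 576 * mcf μ 1 t + 1728 * mcf μ 0 t)
      = 0 := by
  have hc := hS _ (trig_mem 1 0 t)
  have hs := hS _ (trig_mem 0 1 t)
  have i := fun j hj => integrable_mcf μ j t (hm j hj)
  have j0 := i 0 (by norm_num)
  have j1 := i 1 (by norm_num)
  have j2 := i 2 (by norm_num)
  have j3 := i 3 (by norm_num)
  set c0 : ℂ := 24 - 1008 * I * t - 1728 * t ^ 2 with hc0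
  set c1 : ℂ := 50 + 72 * I * t + 576 * t ^ 2 with hc1
  set c2 : ℂ := -1 + 64 * I * t + 48 * t ^ 2 with hc2
  set c3 : ℂ := -16 * t ^ 2 with hc3
  have e : c0 * mcf μ 0 t + c1 * mcf μ 1 t + c2 * mcf μ 2 t + c3 * mcf μ 3 t =
      ∫ y : ℝ, (c0 * ((y : ℂ) ^ 0 * exp (t * y * I)) + c1 * ((y : ℂ) ^ 1 * exp (t * y * I))
        + c2 * ((y : ℂ) ^ 2 * exp (t * y * I)) + c3 * ((y : ℂ) ^ 3 * exp (t * y * I))) ∂μ := by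
    rw [integral_add, integral_add, integral_add]
    · simp only [integral_const_mul, mcf]
    · exact j0.const_mul _
    · exact j1.const_mul _
    · exact (j0.const_mul _).add (j1.const_mul _)
    · exact j2.const_mul _
    · exact ((j0.const_mul _).add (j1.const_mul _)).add (j2.const_mul _)
    · exact j3.const_mul _
  have hint : Integrable (fun y : ℝ => (c0 * ((y : ℂ) ^ 0 * exp (t * y * I))
        + c1 * ((y : ℂ) ^ 1 * exp (t * y * I))
        + c2 * ((y : ℂ) ^ 2 * exp (t * y * I)) + c3 * ((y : ℂ) ^ 3 * exp (t * y * I)))) μ :=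
    (((j0.const_mul _).add (j1.const_mul _)).add (j2.const_mul _)).add (j3.const_mul _)
  have hpt : ∀ y : ℝ, (c0 * ((y : ℂ) ^ 0 * exp (t * y * I))
        + c1 * ((y : ℂ) ^ 1 * exp (t * y * I))
        + c2 * ((y : ℂ) ^ 2 * exp (t * y * I)) + c3 * ((y : ℂ) ^ 3 * exp (t * y * I))) =
      ((steinH4' (fun y : ℝ => 1 * Real.cos (t * y) + 0 * Real.sin (t * y)) y : ℝ) : ℂ)
      + ((steinH4' (fun y : ℝ => 0 * Real.cos (t * y) + 1 * Real.sin (t * y)) y : ℝ) : ℂ) * I := by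
    intro y
    simp only [steinH4', trig_deriv, trig_iter2]
    rw [exp_mul_I]
    push_cast
    rw [hc0, hc1, hc2, hc3]
    linear_combination (-(1008 : ℂ) * t + 72 * t * y + 64 * t * y ^ 2) * sin (t * y) * I_sq
  have hre : ∀ y : ℝ, (c0 * ((y : ℂ) ^ 0 * exp (t * y * I))
        + c1 * ((y : ℂ) ^ 1 * exp (t * y * I))
        + c2 * ((y : ℂ) ^ 2 * exp (t * y * I)) + c3 * ((y : ℂ) ^ 3 * exp (t * y * I))).re =
      steinH4' (fun y : ℝ => 1 * Real.cos (t * y) + 0 * Real.sin (t * y)) y := by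
    intro y; rw [hpt y]; simp
  have him : ∀ y : ℝ, (c0 * ((y : ℂ) ^ 0 * exp (t * y * I))
        + c1 * ((y : ℂ) ^ 1 * exp (t * y * I))
        + c2 * ((y : ℂ) ^ 2 * exp (t * y * I)) + c3 * ((y : ℂ) ^ 3 * exp (t * y * I))).im =
      steinH4' (fun y : ℝ => 0 * Real.cos (t * y) + 1 * Real.sin (t * y)) y := by
    intro y; rw [hpt y]; simp
  have h0 : c0 * mcf μ 0 t + c1 * mcf μ 1 t + c2 * mcf μ 2 t + c3 * mcf μ 3 t = 0 := by
    rw [e]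
    have hr := integral_re hint
    have hi := integral_im hint
    apply Complex.ext
    · refine Eq.trans hr.symm (Eq.trans (integral_congr_ae (ae_of_all _ hre)) hc)
    · refine Eq.trans hi.symm (Eq.trans (integral_congr_ae (ae_of_all _ him)) hs)
  rw [hc0, hc1, hc2, hc3] at h0
  linear_combination h0

lemma law_unique (μ : Measure ℝ) [IsProbabilityMeasure μ]
    (hm : ∀ j ≤ 3, Integrable (fun y : ℝ => y ^ j) μ) (hmean : ∫ y, y ∂μ = 0)
    (hS : ∀ f, memFH4' f → ∫ y, steinH4' f y ∂μ = 0) : μ = lawH4 := by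
  have hm' : ∀ j ≤ 3, Integrable (fun y : ℝ => y ^ j) lawH4 := fun j _ => integrable_pow_lawH4 j
  have hd : ∀ j < 3, ∀ t, HasDerivAt (fun t => mcf μ j t - mcf lawH4 j t)
      (Complex.I * (mcf μ (j + 1) t - mcf lawH4 (j + 1) t)) t := fun j hj t => by
    rw [mul_sub]
    exact (hasDerivAt_mcf μ j t (hm j hj.le) (hm _ hj)).sub
      (hasDerivAt_mcf lawH4 j t (hm' j hj.le) (hm' _ hj))
  have hpos : ∀ t, 0 < t → charFun μ t = charFun lawH4 t := by
    intro t ht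
    have := ode_unique (fun t => mcf μ 0 t - mcf lawH4 0 t) (fun t => mcf μ 1 t - mcf lawH4 1 t)
      (fun t => mcf μ 2 t - mcf lawH4 2 t) (fun t => mcf μ 3 t - mcf lawH4 3 t)
      (hd 0 (by norm_num)) (hd 1 (by norm_num)) (hd 2 (by norm_num))
      (by simp [mcf])
      (by
        have a : mcf μ 1 0 = 0 := by
          simp only [mcf, Complex.ofReal_zero, zero_mul, Complex.exp_zero, mul_one, pow_one]
          rw [integral_complex_ofReal, hmean, Complex.ofReal_zero]
        have b : mcf lawH4 1 0 = 0 := by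
          simp only [mcf, Complex.ofReal_zero, zero_mul, Complex.exp_zero, mul_one, pow_one]
          rw [integral_complex_ofReal, integral_id_lawH4, Complex.ofReal_zero]
        simp [a, b])
      (fun t => by
        have a := mcf_ode μ hm hS t
        have b := mcf_ode lawH4 hm' stein_lawH4 t
        linear_combination a - b) t ht
    rw [charFun_apply_real, charFun_apply_real]
    simpa [mcf, sub_eq_zero] using this
  apply Measure.ext_of_charFun
  ext t
  rcases lt_trichotomy t 0 with h | h | h
  · have := hpos (-t) (by linarith)
    rw [charFun_neg, charFun_neg] at this
    exact (starRingEnd ℂ).injective this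
  · simp [h]
  · exact hpos t h

/-- Stein characterisation of `H₄(X) = X⁴ - 6X² + 3`, `X ∼ N(0,1)`, via
the second-order operator `S₄'`, among mean-zero random variables with finite third
absolute moment. -/
theorem stein_characterisation_H4_second_order
    {Ω : Type*} [MeasurableSpace Ω] (ν : Measure Ω) [IsProbabilityMeasure ν]
    (W : Ω → ℝ) (hW : Measurable W)
    (hWmean : ∫ ω, W ω ∂ν = 0)
    (hWmom : Integrable (fun ω => |W ω| ^ 3) ν) :
    Measure.map W ν = lawH4 ↔
      ∀ f : ℝ → ℝ, memFH4' f → ∫ ω, steinH4' f (W ω) ∂ν = 0 := by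
  have key : ∀ f, memFH4' f →
      ∫ ω, steinH4' f (W ω) ∂ν = ∫ y, steinH4' f y ∂(Measure.map W ν) := by
    intro f hf
    have c0 : Continuous f := hf.1.continuous
    have c1 : Continuous (deriv f) := hf.1.continuous_deriv (by norm_num)
    have c2 : Continuous (iteratedDeriv 2 f) := hf.1.continuous_iteratedDeriv 2 le_rfl
    have cS : Continuous (steinH4' f) := by unfold steinH4'; fun_prop
    rw [integral_map hW.aemeasurable cS.aestronglyMeasurable]
  constructor
  · intro h f hf
    rw [key f hf, h]
    exact stein_lawH4 f hf
  · intro h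
    have : IsProbabilityMeasure (Measure.map W ν) :=
      Measure.isProbabilityMeasure_map hW.aemeasurable
    refine law_unique _ (fun j hj => ?_) ?_ (fun f hf => by rw [← key f hf]; exact h f hf)
    · rw [integrable_map_measure (by fun_prop) hW.aemeasurable]
      refine ((integrable_const (1 : ℝ)).add hWmom).mono' (by fun_prop) (ae_of_all _ fun ω => ?_)
      simp only [Function.comp, norm_pow, Real.norm_eq_abs, Pi.add_apply]
      rcases le_total |W ω| 1 with h1 | h1
      · have := pow_le_one₀ (abs_nonneg (W ω)) h1 (n := j)
        have := pow_nonneg (abs_nonneg (W ω)) 3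
        linarith
      · have := pow_le_pow_right₀ h1 hj
        linarith
    · rw [integral_map hW.aemeasurable (by fun_prop)]
      exact hWmean
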